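/- arXiv:1308.5420 — 2 statements merged into one kernel-verified Lean document; each statement's English description precedes it below -/
import Mathlib

section
/- f(8) = 10 and f(9) = 10: for n = 8 and n = 9, the n×n square admits a prime dissection into exactly 10 integer-sided squares, and admits no prime dissection into fewer than 10 squares. -/
/-- The closed square with lower-left corner `(q.1, q.2.1)` and side `q.2.2`,
as a subset of the plane. -/
def closedSq (q : ℕ × ℕ × ℕ) : Set (ℝ × ℝ) :=
  Set.Icc (q.1 : ℝ) (q.1 + q.2.2) ×ˢ Set.Icc (q.2.1 : ℝ) (q.2.1 + q.2.2)

/-- The interior (open square) of the placed square `q`. -/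
def openSq (q : ℕ × ℕ × ℕ) : Set (ℝ × ℝ) :=
  Set.Ioo (q.1 : ℝ) (q.1 + q.2.2) ×ˢ Set.Ioo (q.2.1 : ℝ) (q.2.1 + q.2.2)

/-- `D` is a dissection of the `n × n` square: a finite family of axis-aligned
squares with positive integer side lengths and integer lower-left corners, whose
interiors are pairwise disjoint and whose union is `[0,n] × [0,n]`.  Its order is
`D.card`. -/
def IsDissection (n : ℕ) (D : Finset (ℕ × ℕ × ℕ)) : Prop :=
  (∀ q ∈ D, 0 < q.2.2) ∧
  (⋃ q ∈ D, closedSq q) = Set.Icc (0 : ℝ) (n : ℝ) ×ˢ Set.Icc (0 : ℝ) (n : ℝ) ∧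
  (∀ q ∈ D, ∀ q' ∈ D, q ≠ q' → openSq q ∩ openSq q' = ∅)

/-- A dissection is prime if the gcd of the side lengths of its squares is 1. -/
def IsPrimeDissection (n : ℕ) (D : Finset (ℕ × ℕ × ℕ)) : Prop :=
  IsDissection n D ∧ D.gcd (fun q => q.2.2) = 1

def cov (q : ℕ × ℕ × ℕ) (i j : ℕ) : Prop :=
  (q.1 ≤ i ∧ i < q.1 + q.2.2) ∧ (q.2.1 ≤ j ∧ j < q.2.1 + q.2.2)

instance covDec (q : ℕ × ℕ × ℕ) (i j : ℕ) : Decidable (cov q i j) := by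
  unfold cov; infer_instance

theorem cover_cell {n : ℕ} {D : Finset (ℕ × ℕ × ℕ)} (h : IsDissection n D) (i j : ℕ)
    (hi : i < n) (hj : j < n) : ∃ q ∈ D, cov q i j := by
  have h1 : ((i : ℝ) + 1/2, (j : ℝ) + 1/2) ∈ ⋃ q ∈ D, closedSq q := by
    rw [h.2.1]
    have hi' : (i : ℝ) + 1 ≤ n := by exact_mod_cast hi
    have hj' : (j : ℝ) + 1 ≤ n := by exact_mod_cast hj
    have := Nat.cast_nonneg (α := ℝ) i
    have := Nat.cast_nonneg (α := ℝ) j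
    refine ⟨⟨?_, ?_⟩, ⟨?_, ?_⟩⟩ <;> simp only <;> linarith
  simp only [Set.mem_iUnion] at h1
  obtain ⟨q, hq, ⟨h1, h2⟩, ⟨h3, h4⟩⟩ := h1
  simp only at h1 h2 h3 h4
  refine ⟨q, hq, ⟨?_, ?_⟩, ⟨?_, ?_⟩⟩
  · have : (q.1 : ℝ) < (i + 1 : ℕ) := by push_cast; linarith
    have := Nat.cast_lt.1 this
    omega
  · have : (i : ℝ) < (q.1 + q.2.2 : ℕ) := by push_cast; linarith
    exact Nat.cast_lt.1 this
  · have : (q.2.1 : ℝ) < (j + 1 : ℕ) := by push_cast; linarith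
    have := Nat.cast_lt.1 this
    omega
  · have : (j : ℝ) < (q.2.1 + q.2.2 : ℕ) := by push_cast; linarith
    exact Nat.cast_lt.1 this

theorem cov_open {q : ℕ × ℕ × ℕ} {i j : ℕ} (h : cov q i j) :
    ((i : ℝ) + 1/2, (j : ℝ) + 1/2) ∈ openSq q := by
  obtain ⟨⟨h1, h2⟩, ⟨h3, h4⟩⟩ := h
  have h1 : (q.1 : ℝ) ≤ i := by exact_mod_cast h1
  have h2 : (i : ℝ) + 1 ≤ q.1 + q.2.2 := by exact_mod_cast h2
  have h3 : (q.2.1 : ℝ) ≤ j := by exact_mod_cast h3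
  have h4 : (j : ℝ) + 1 ≤ q.2.1 + q.2.2 := by exact_mod_cast h4
  refine ⟨⟨?_, ?_⟩, ⟨?_, ?_⟩⟩ <;> simp only <;> linarith

theorem uniq_cell {n : ℕ} {D : Finset (ℕ × ℕ × ℕ)} (h : IsDissection n D)
    {q q' : ℕ × ℕ × ℕ} (hq : q ∈ D) (hq' : q' ∈ D) {i j : ℕ}
    (h1 : cov q i j) (h2 : cov q' i j) : q = q' := by
  by_contra hne
  have := h.2.2 q hq q' hq' hne
  have h3 : ((i : ℝ) + 1/2, (j : ℝ) + 1/2) ∈ openSq q ∩ openSq q' :=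
    ⟨cov_open h1, cov_open h2⟩
  rw [this] at h3
  exact h3

theorem bound_sq {n : ℕ} {D : Finset (ℕ × ℕ × ℕ)} (h : IsDissection n D)
    {q : ℕ × ℕ × ℕ} (hq : q ∈ D) : q.1 + q.2.2 ≤ n ∧ q.2.1 + q.2.2 ≤ n := by
  have h1 : ((q.1 : ℝ) + q.2.2, (q.2.1 : ℝ) + q.2.2) ∈ ⋃ q ∈ D, closedSq q := by
    simp only [Set.mem_iUnion]
    refine ⟨q, hq, ⟨?_, ?_⟩, ⟨?_, ?_⟩⟩ <;> simp
  rw [h.2.1] at h1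
  obtain ⟨⟨_, h2⟩, ⟨_, h4⟩⟩ := h1
  simp only at h2 h4
  exact ⟨by exact_mod_cast h2, by exact_mod_cast h4⟩

/-- Purely combinatorial sufficient criterion. -/
theorem mk_dissection (n : ℕ) (hn : 0 < n) (D : Finset (ℕ × ℕ × ℕ))
    (hpos : ∀ q ∈ D, 0 < q.2.2 ∧ q.1 + q.2.2 ≤ n ∧ q.2.1 + q.2.2 ≤ n)
    (hcov : ∀ i < n, ∀ j < n, ∃ q ∈ D, cov q i j)
    (hdis : ∀ q ∈ D, ∀ q' ∈ D, q ≠ q' → q.1 + q.2.2 ≤ q'.1 ∨ q'.1 + q'.2.2 ≤ q.1 ∨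
      q.2.1 + q.2.2 ≤ q'.2.1 ∨ q'.2.1 + q'.2.2 ≤ q.2.1) : IsDissection n D := by
  have key : ∀ x : ℝ, 0 ≤ x → x ≤ n → ∃ i : ℕ, i < n ∧ (i : ℝ) ≤ x ∧ x ≤ i + 1 := by
    intro x h0 hx
    by_cases hlt : x < n
    · exact ⟨⌊x⌋₊, (Nat.floor_lt h0).2 hlt, Nat.floor_le h0, (Nat.lt_floor_add_one x).le⟩
    · have : x = n := le_antisymm hx (not_lt.1 hlt)
      obtain ⟨m, rfl⟩ : ∃ m, n = m + 1 := ⟨n - 1, by omega⟩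
      refine ⟨m, by omega, ?_, ?_⟩ <;> rw [this] <;> push_cast <;> linarith
  refine ⟨fun q hq => (hpos q hq).1, ?_, ?_⟩
  · apply Set.Subset.antisymm
    · intro z hz
      simp only [Set.mem_iUnion] at hz
      obtain ⟨q, hq, ⟨h1, h2⟩, ⟨h3, h4⟩⟩ := hz
      obtain ⟨_, h5, h6⟩ := hpos q hq
      have h5 : (q.1 : ℝ) + q.2.2 ≤ n := by exact_mod_cast h5
      have h6 : (q.2.1 : ℝ) + q.2.2 ≤ n := by exact_mod_cast h6
      have := Nat.cast_nonneg (α := ℝ) q.1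
      have := Nat.cast_nonneg (α := ℝ) q.2.1
      refine ⟨⟨?_, ?_⟩, ⟨?_, ?_⟩⟩ <;> linarith
    · rintro ⟨x, y⟩ ⟨⟨h1, h2⟩, ⟨h3, h4⟩⟩
      obtain ⟨i, hi, hi1, hi2⟩ := key x h1 h2
      obtain ⟨j, hj, hj1, hj2⟩ := key y h3 h4
      obtain ⟨q, hq, ⟨a1, a2⟩, ⟨a3, a4⟩⟩ := hcov i hi j hj
      simp only [Set.mem_iUnion]
      have a1 : (q.1 : ℝ) ≤ i := by exact_mod_cast a1
      have a2 : (i : ℝ) + 1 ≤ q.1 + q.2.2 := by exact_mod_cast a2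
      have a3 : (q.2.1 : ℝ) ≤ j := by exact_mod_cast a3
      have a4 : (j : ℝ) + 1 ≤ q.2.1 + q.2.2 := by exact_mod_cast a4
      refine ⟨q, hq, ⟨?_, ?_⟩, ⟨?_, ?_⟩⟩ <;> simp only <;> linarith
  · intro q hq q' hq' hne
    ext z
    simp only [Set.mem_inter_iff, Set.mem_empty_iff_false, iff_false]
    rintro ⟨⟨⟨h1, h2⟩, ⟨h3, h4⟩⟩, ⟨⟨k1, k2⟩, ⟨k3, k4⟩⟩⟩
    rcases hdis q hq q' hq' hne with h | h | h | h
    · have h : (q.1 : ℝ) + q.2.2 ≤ q'.1 := by exact_mod_cast h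
      linarith
    · have h : (q'.1 : ℝ) + q'.2.2 ≤ q.1 := by exact_mod_cast h
      linarith
    · have h : (q.2.1 : ℝ) + q.2.2 ≤ q'.2.1 := by exact_mod_cast h
      linarith
    · have h : (q'.2.1 : ℝ) + q'.2.2 ≤ q.2.1 := by exact_mod_cast h
      linarith

/-- Bit mask of an `s`-wide, `t`-high rectangle at the origin of an `n`-wide grid. -/
def sqm (n s : ℕ) : ℕ → ℕ
  | 0 => 0
  | t + 1 => sqm n s t ||| ((2 ^ s - 1) <<< (n * t))

theorem sqm_bit (n s t p r : ℕ) : ((sqm n s t) <<< p).testBit r = true ↔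
    ∃ u < t, p + n * u ≤ r ∧ r < p + n * u + s := by
  induction t with
  | zero => simp [sqm]
  | succ t ih =>
    simp only [Nat.testBit_shiftLeft, Bool.and_eq_true, decide_eq_true_eq] at ih
    simp only [sqm, Nat.testBit_shiftLeft, Nat.testBit_or, Nat.testBit_two_pow_sub_one,
      Bool.and_eq_true, Bool.or_eq_true, decide_eq_true_eq, and_or_left, ih]
    constructor
    · rintro (⟨u, hu, h⟩ | h)
      · exact ⟨u, by omega, h⟩
      · exact ⟨t, by omega, by omega, by omega⟩
    · rintro ⟨u, hu, h⟩
      rcases Nat.lt_succ_iff_lt_or_eq.1 hu with h' | rfl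
      · exact Or.inl ⟨u, h', h⟩
      · right; omega

theorem sqm_cov (n : ℕ) (hn : n = 8 ∨ n = 9) (x y s i j : ℕ) (hx : x + s ≤ n) (hi : i < n) :
    ((sqm n s s) <<< (n * y + x)).testBit (n * j + i) = true ↔ cov (x, y, s) i j := by
  rw [sqm_bit]
  unfold cov
  simp only
  constructor
  · rintro ⟨u, hu, h1, h2⟩
    rcases hn with rfl | rfl <;> omega
  · rintro ⟨h1, h2⟩
    refine ⟨j - y, by omega, ?_, ?_⟩ <;> rcases hn with rfl | rfl <;> omega

def np (m : ℕ) : ℕ := Nat.log2 (Nat.xor m (Nat.succ m))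

def chk (m p : ℕ) : Bool :=
  Nat.beq (Nat.mod m (Nat.pow 2 (Nat.succ p))) (Nat.sub (Nat.pow 2 p) 1)

/-- Makes the kernel evaluate `a` before it is passed on. -/
noncomputable def force (a : ℕ) (f : ℕ → Bool) : Bool :=
  Nat.rec (f 0) (fun k _ => f (Nat.succ k)) a

theorem force_eq (a : ℕ) (f : ℕ → Bool) : force a f = f a := by
  cases a <;> rfl

noncomputable def lall (f : ℕ → ℕ → Bool) (L : List (ℕ × ℕ)) : Bool :=
  List.rec true (fun t _ ih => cond (f t.1 t.2) ih false) L

theorem lall_mem {f : ℕ → ℕ → Bool} {L : List (ℕ × ℕ)} (h : lall f L = true) :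
    ∀ t ∈ L, f t.1 t.2 = true := by
  induction L with
  | nil => simp
  | cons a L ih =>
    have h' : cond (f a.1 a.2) (lall f L) false = true := h
    cases hf : f a.1 a.2
    · simp [hf] at h'
    · rw [hf] at h'
      intro t ht
      rcases List.mem_cons.1 ht with rfl | ht
      · exact hf
      · exact ih h' t ht

/-- Exhaustive search, written with recursors for fast kernel evaluation.  All cells before `p`
are filled, the filled cells from `p` on are the bits of `w`. -/
noncomputable def srch (n d : ℕ) (L : List (ℕ × ℕ)) (k : ℕ) : ℕ → ℕ → Bool → Bool :=
  Nat.rec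
    (fun p0 w b => force (np w) fun t =>
      cond (chk w t) (cond (Nat.ble (Nat.mul n n) (Nat.add p0 t)) b true) false)
    (fun _ ih p0 w b => force (np w) fun t =>
      cond (chk w t) (force (Nat.add p0 t) fun p => cond (Nat.ble (Nat.mul n n) p) b
        (force (Nat.shiftRight w t) fun v => lall (fun s q =>
          cond (Nat.ble (Nat.add (Nat.mod p n) s) n)
            (cond (Nat.ble (Nat.add (Nat.div p n) s) n)
              (cond (Nat.beq (Nat.land v q) 0)
                (force (Nat.lor v q) fun v' =>
                  ih p v' (cond b (Nat.beq (Nat.mod s d) 0) false))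
                true)
              true)
            true) L)) false) k

theorem srch_zero (n d : ℕ) (L : List (ℕ × ℕ)) (p0 w : ℕ) (b : Bool) :
    srch n d L 0 p0 w b =
      cond (chk w (np w)) (cond (Nat.ble (n * n) (p0 + np w)) b true) false := by
  unfold srch
  exact force_eq (np w) _

theorem srch_succ (n d : ℕ) (L : List (ℕ × ℕ)) (k p0 w : ℕ) (b : Bool) :
    srch n d L (k + 1) p0 w b = cond (chk w (np w))
      (force (p0 + np w) fun p => cond (Nat.ble (n * n) p) b
        (force (w >>> (np w)) fun v => lall (fun s q =>
          cond (Nat.ble (p % n + s) n)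
            (cond (Nat.ble (p / n + s) n)
              (cond (Nat.beq (v &&& q) 0)
                (force (v ||| q) fun v' =>
                  srch n d L k p v' (cond b (Nat.beq (s % d) 0) false))
                true)
              true)
            true) L)) false := by
  unfold srch
  exact force_eq (np w) _

theorem ghost {m p0 w t : ℕ} (h1 : ∀ r < p0, m.testBit r = true)
    (h2 : ∀ r, m.testBit (p0 + r) = w.testBit r)
    (c1 : ∀ r < t, w.testBit r = true) (c2 : w.testBit t = false) :
    (∀ r < p0 + t, m.testBit r = true) ∧ m.testBit (p0 + t) = false := by
  refine ⟨fun r hr => ?_, by rw [h2, c2]⟩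
  by_cases h : r < p0
  · exact h1 r h
  · obtain ⟨u, rfl⟩ := Nat.exists_eq_add_of_le (not_lt.1 h)
    rw [h2]
    exact c1 u (by omega)

theorem chk_lt {m p : ℕ} (h : chk m p = true) : (∀ r < p, m.testBit r = true) ∧
    m.testBit p = false := by
  have h : m % 2 ^ (p + 1) = 2 ^ p - 1 := Nat.eq_of_beq_eq_true h
  have key : ∀ r < p + 1, m.testBit r = decide (r < p) := by
    intro r hr
    have := congrArg (fun z => z.testBit r) h
    simpa only [Nat.testBit_mod_two_pow, Nat.testBit_two_pow_sub_one, hr, decide_true,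
      Bool.true_and] using this
  exact ⟨fun r hr => by simp [key r (by omega), hr], by simp [key p (by omega)]⟩

theorem srch_chk {n d k p0 w : ℕ} {L : List (ℕ × ℕ)} {b : Bool}
    (h : srch n d L k p0 w b = true) : chk w (np w) = true := by
  by_contra hc
  rw [Bool.not_eq_true] at hc
  cases k
  · simp [srch_zero, hc] at h
  · simp [srch_succ, hc] at h

theorem srch_sound (n d : ℕ) (L : List (ℕ × ℕ)) (hn : n = 8 ∨ n = 9)
    (hL : ∀ s < n + 1, 0 < s → (s, sqm n s s) ∈ L) (D : Finset (ℕ × ℕ × ℕ))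
    (h : IsDissection n D) : ∀ (k m p0 w : ℕ) (b : Bool) (P : Finset (ℕ × ℕ × ℕ)), P ⊆ D →
    (∀ r < p0, m.testBit r = true) → (∀ r, m.testBit (p0 + r) = w.testBit r) →
    (∀ i < n, ∀ j < n, m.testBit (n * j + i) = true ↔ ∃ q ∈ P, cov q i j) →
    (∀ i < n, ∀ j, n ≤ j → m.testBit (n * j + i) = false) →
    D.card ≤ P.card + k → (b = true → ∀ q ∈ P, d ∣ q.2.2) → srch n d L k p0 w b = true →
    ∀ q ∈ D, d ∣ q.2.2 := by
  have hn0 : 0 < n := by rcases hn with rfl | rfl <;> norm_num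
  intro k
  induction k with
  | zero =>
    intro m p0 w b P hP g1 g2 hm hm2 hc hb hs
    have hck := srch_chk hs
    obtain ⟨e1, e2⟩ := chk_lt hck
    obtain ⟨c1, c2⟩ := ghost g1 g2 e1 e2
    set p := p0 + np w with hpdef
    have hPD : P = D := Finset.eq_of_subset_of_card_le hP (by omega)
    subst hPD
    rw [srch_zero, hck, cond_true, ← hpdef] at hs
    by_cases hp : p < n * n
    · exfalso
      have hi := Nat.mod_lt (p) hn0
      have hj : p / n < n := Nat.div_lt_of_lt_mul hp
      have := (hm _ hi _ hj).2 (cover_cell h _ _ hi hj)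
      rw [Nat.div_add_mod, c2] at this
      exact absurd this (by simp)
    · rw [Nat.ble_eq_true_of_le (not_lt.1 hp)] at hs
      exact hb hs
  | succ k ih =>
    intro m p0 w b P hP g1 g2 hm hm2 hc hb hs
    have hck := srch_chk hs
    obtain ⟨e1, e2⟩ := chk_lt hck
    obtain ⟨c1, c2⟩ := ghost g1 g2 e1 e2
    set p := p0 + np w with hpdef
    rw [srch_succ, hck, cond_true, force_eq, ← hpdef] at hs
    by_cases hp : n * n ≤ p
    · rw [Nat.ble_eq_true_of_le hp] at hs
      intro q hq
      apply hb hs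
      have hpos := h.1 q hq
      obtain ⟨b1, b2⟩ := bound_sq h hq
      have hlt : n * q.2.1 + q.1 < p := by
        have : n * q.2.1 + q.1 < n * n := by rcases hn with rfl | rfl <;> omega
        omega
      have hcv : cov q q.1 q.2.1 := by unfold cov; omega
      obtain ⟨q', hq', hc'⟩ := (hm q.1 (by omega) q.2.1 (by omega)).1 (c1 _ hlt)
      rwa [uniq_cell h hq (hP hq') hcv hc']
    · have hble : Nat.ble (n * n) (p) = false := by
        rw [Bool.eq_false_iff]; intro hh; exact hp (Nat.le_of_ble_eq_true hh)
      rw [hble] at hs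
      rw [cond_false, force_eq] at hs
      have hs := lall_mem hs
      push Not at hp
      have hi := Nat.mod_lt p hn0
      have hj : p / n < n := Nat.div_lt_of_lt_mul hp
      have hdm := Nat.div_add_mod p n
      obtain ⟨q, hq, hcq⟩ := cover_cell h _ _ hi hj
      have hqP : q ∉ P := by
        intro hqP
        have := (hm _ hi _ hj).2 ⟨q, hqP, hcq⟩
        rw [hdm, c2] at this
        exact absurd this (by simp)
      have hpos := h.1 q hq
      obtain ⟨b1, b2⟩ := bound_sq h hq
      have hcv : cov q q.1 q.2.1 := by unfold cov; omega
      have hge : ¬ (n * q.2.1 + q.1 < p) := by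
        intro hlt
        obtain ⟨q', hq', hc'⟩ := (hm q.1 (by omega) q.2.1 (by omega)).1 (c1 _ hlt)
        rw [uniq_cell h hq (hP hq') hcv hc'] at hqP
        exact hqP hq'
      have hcq' := hcq
      unfold cov at hcq'
      have hxy : q.1 = p % n ∧ q.2.1 = p / n := by
        rcases hn with rfl | rfl <;> omega
      obtain ⟨x, y, s⟩ := q
      simp only at hxy hpos b1 b2
      obtain ⟨rfl, rfl⟩ := hxy
      have hbit := fun i j (hi : i < n) => sqm_cov n hn (p % n) (p / n) s i j b1 hi
      rw [hdm] at hbit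
      have hland : ((sqm n s s) <<< p) &&& m = 0 := by
        apply Nat.eq_of_testBit_eq
        intro r
        rw [Nat.testBit_and, Nat.zero_testBit, Bool.eq_false_iff]
        intro hr
        rw [Bool.and_eq_true] at hr
        have hrm := Nat.mod_lt r hn0
        have e := Nat.div_add_mod r n
        rw [← e] at hr
        have h1 := (hbit _ _ hrm).1 hr.1
        have hlt : r / n < n := by have := h1.2.2; simp only at this; omega
        obtain ⟨q', hq', hc'⟩ := (hm _ hrm _ hlt).1 hr.2
        rw [uniq_cell h hq (hP hq') h1 hc'] at hqP
        exact hqP hq'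
      have hs := hs _ (hL s (by omega) hpos)
      have g3 : ∀ r, m.testBit (p + r) = (w >>> (np w)).testBit r := by
        intro r
        rw [Nat.testBit_shiftRight, ← g2, hpdef, Nat.add_assoc]
      have hland2 : (w >>> (np w)) &&& sqm n s s = 0 := by
        apply Nat.eq_of_testBit_eq
        intro r
        have := congrArg (fun z => z.testBit (p + r)) hland
        simp only [Nat.testBit_and, Nat.testBit_shiftLeft, Nat.zero_testBit, g3] at this ⊢
        rw [Bool.and_comm]
        simpa using this
      have hs' : srch n d L k p ((w >>> (np w)) ||| sqm n s s)
          (cond b (Nat.beq (s % d) 0) false) = true := by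
        simpa only [force_eq, hland2, Nat.ble_eq_true_of_le b1, Nat.ble_eq_true_of_le b2,
          cond_true, Nat.beq_refl] using hs
      refine ih (m ||| ((sqm n s s) <<< p)) _ _ _ (insert (p % n, p / n, s) P)
        (Finset.insert_subset hq hP) ?_ ?_ ?_ ?_ ?_ ?_ hs'
      · intro r hr
        rw [Nat.testBit_or, c1 r hr, Bool.true_or]
      · intro r
        simp [Nat.testBit_or, Nat.testBit_shiftLeft, g3]
      · intro i hi j hj
        rw [Nat.testBit_or, Bool.or_eq_true, hbit i j hi, hm i hi j hj]
        simp only [Finset.mem_insert, exists_eq_or_imp]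
        exact or_comm
      · intro i hi j hj
        rw [Nat.testBit_or, hm2 i hi j hj, Bool.false_or, Bool.eq_false_iff]
        intro hh
        have := ((hbit i j hi).1 hh).2.2
        simp only at this
        omega
      · rw [Finset.card_insert_of_notMem hqP]; omega
      · intro hb'
        simp only [Bool.cond_false_right, Bool.and_eq_true, Nat.beq_eq] at hb'
        intro q' hq'
        rcases Finset.mem_insert.1 hq' with rfl | hq'
        · exact Nat.dvd_of_mod_eq_zero hb'.2
        · exact hb hb'.1 q' hq'

def tab8 : List (ℕ × ℕ) :=
  [(1, 1), (2, 771), (3, 460551), (4, 252645135), (5, 133666119455), (6, 69540876599103), (7, 35887507618889599), (8, 18446744073709551615)]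

def tab9 : List (ℕ × ℕ) :=
  [(1, 1), (2, 1539), (3, 1838599), (4, 2017205775), (5, 2134472670751), (6, 2220953240895039), (7, 2292305770412047999), (8, 2356562530590527454975), (9, 2417851639229258349412351)]

theorem run8 : srch 8 2 tab8 9 0 0 true = true := by decide +kernel

theorem run9 : srch 9 3 tab9 9 0 0 true = true := by decide +kernel

theorem lower (n d : ℕ) (L : List (ℕ × ℕ)) (hn : n = 8 ∨ n = 9)
    (hL : ∀ s < n + 1, 0 < s → (s, sqm n s s) ∈ L) (hd : d ≠ 1) (hr : srch n d L 9 0 0 true = true)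
    (D : Finset (ℕ × ℕ × ℕ)) (h : IsPrimeDissection n D) : 10 ≤ D.card := by
  by_contra hc
  have := srch_sound n d L hn hL D h.1 9 0 0 0 true ∅ (by simp) (by simp) (by simp) (by simp) (by simp)
    (by simp; omega) (by simp) hr
  have h2 := Finset.dvd_gcd this
  rw [h.2] at h2
  exact hd (Nat.dvd_one.1 h2)

theorem f_eight_and_nine_eq_ten :
    ((∃ D : Finset (ℕ × ℕ × ℕ), IsPrimeDissection 8 D ∧ D.card = 10) ∧
      (∀ D : Finset (ℕ × ℕ × ℕ), IsPrimeDissection 8 D → 10 ≤ D.card)) ∧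
    ((∃ D : Finset (ℕ × ℕ × ℕ), IsPrimeDissection 9 D ∧ D.card = 10) ∧
      (∀ D : Finset (ℕ × ℕ × ℕ), IsPrimeDissection 9 D → 10 ≤ D.card)) := by
  refine ⟨⟨⟨{(0, 0, 5), (5, 0, 3), (5, 3, 3), (0, 5, 3), (3, 5, 2), (5, 6, 2), (7, 6, 1),
      (3, 7, 1), (4, 7, 1), (7, 7, 1)}, ⟨mk_dissection 8 (by norm_num) _ ?_ ?_ ?_, ?_⟩, ?_⟩,
      lower 8 2 tab8 (by simp) (by decide +kernel) (by simp) run8⟩,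
    ⟨{(0, 0, 5), (5, 0, 4), (5, 4, 2), (7, 4, 2), (0, 5, 4), (4, 5, 1), (4, 6, 3), (7, 6, 2),
      (7, 8, 1), (8, 8, 1)}, ⟨mk_dissection 9 (by norm_num) _ ?_ ?_ ?_, ?_⟩, ?_⟩,
      lower 9 3 tab9 (by simp) (by decide +kernel) (by simp) run9⟩ <;> decide +kernel
end

section
/- The number of dissections of the 4×4 square into integer-sided squares is 40, and the number of dissections of the 5×5 square into integer-sided squares is 472. -/
def sepSq (p q : ℕ × ℕ × ℕ) : Prop :=
  p.1 + p.2.2 ≤ q.1 ∨ q.1 + q.2.2 ≤ p.1 ∨ p.2.1 + p.2.2 ≤ q.2.1 ∨ q.2.1 + q.2.2 ≤ p.2.1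

instance sepSqDec : DecidableRel sepSq := fun p q => by unfold sepSq; infer_instance

theorem sepSq_symm {p q : ℕ × ℕ × ℕ} (h : sepSq p q) : sepSq q p := by
  unfold sepSq at *; tauto

def covers (q : ℕ × ℕ × ℕ) (i j : ℕ) : Prop :=
  q.1 ≤ i ∧ i + 1 ≤ q.1 + q.2.2 ∧ q.2.1 ≤ j ∧ j + 1 ≤ q.2.1 + q.2.2

theorem covers_not_sep {p q : ℕ × ℕ × ℕ} {i j : ℕ} (hp : covers p i j) (hq : covers q i j) :
    ¬ sepSq p q := by
  unfold sepSq covers at *; omega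

def IsDisc (n : ℕ) (D : Finset (ℕ × ℕ × ℕ)) : Prop :=
  (∀ q ∈ D, 0 < q.2.2 ∧ q.1 + q.2.2 ≤ n ∧ q.2.1 + q.2.2 ≤ n) ∧
  (∀ i j, i < n → j < n → ∃ q ∈ D, covers q i j) ∧
  (∀ q ∈ D, ∀ q' ∈ D, q ≠ q' → sepSq q q')

theorem half_lo {a i : ℕ} (h : (a : ℝ) ≤ i + 1 / 2) : a ≤ i := by
  by_contra hc
  have : i + 1 ≤ a := by omega
  have : (i : ℝ) + 1 ≤ a := by exact_mod_cast this
  linarith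

theorem half_hi {a s i : ℕ} (h : (i : ℝ) + 1 / 2 ≤ a + s) : i + 1 ≤ a + s := by
  by_contra hc
  have : a + s ≤ i := by omega
  have : (a : ℝ) + s ≤ i := by exact_mod_cast this
  linarith

theorem exists_cell {n : ℕ} (hn : 0 < n) {u : ℝ} (h0 : 0 ≤ u) (h1 : u ≤ n) :
    ∃ i : ℕ, i < n ∧ (i : ℝ) ≤ u ∧ u ≤ i + 1 := by
  rcases h1.lt_or_eq with h | h
  · exact ⟨⌊u⌋₊, (Nat.floor_lt h0).2 h, Nat.floor_le h0, (Nat.lt_floor_add_one u).le⟩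
  · refine ⟨n - 1, by omega, ?_, ?_⟩
    · rw [h]; exact_mod_cast Nat.sub_le n 1
    · rw [h]; exact_mod_cast (by omega : n ≤ n - 1 + 1)

theorem exists_common {a s b t : ℕ} (h1 : ¬ a + s ≤ b) (h2 : ¬ b + t ≤ a) (hs : 0 < s)
    (ht : 0 < t) : ∃ u : ℝ, ((a : ℝ) < u ∧ u < a + s) ∧ ((b : ℝ) < u ∧ u < b + t) := by
  have e1 : (b : ℝ) + 1 ≤ a + s := by exact_mod_cast (by omega : b + 1 ≤ a + s)
  have e2 : (a : ℝ) + 1 ≤ b + t := by exact_mod_cast (by omega : a + 1 ≤ b + t)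
  have e3 : (1 : ℝ) ≤ s := by exact_mod_cast hs
  have e4 : (1 : ℝ) ≤ t := by exact_mod_cast ht
  rcases le_total (a : ℝ) b with h | h
  · exact ⟨b + 1 / 2, ⟨by linarith, by linarith⟩, by linarith, by linarith⟩
  · exact ⟨a + 1 / 2, ⟨by linarith, by linarith⟩, by linarith, by linarith⟩

theorem isDissection_iff {n : ℕ} (hn : 0 < n) (D : Finset (ℕ × ℕ × ℕ)) :
    IsDissection n D ↔ IsDisc n D := by
  constructor
  · rintro ⟨hpos, hun, hdis⟩
    refine ⟨?_, ?_, ?_⟩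
    · intro q hq
      have hm : ((q.1 : ℝ) + q.2.2, (q.2.1 : ℝ) + q.2.2) ∈ ⋃ q ∈ D, closedSq q := by
        simp only [Set.mem_iUnion]
        refine ⟨q, hq, ?_⟩
        simp [closedSq]
      rw [hun] at hm
      simp only [Set.mem_prod, Set.mem_Icc] at hm
      exact ⟨hpos q hq, by exact_mod_cast hm.1.2, by exact_mod_cast hm.2.2⟩
    · intro i j hi hj
      have hi' : (i : ℝ) + 1 ≤ n := by exact_mod_cast hi
      have hj' : (j : ℝ) + 1 ≤ n := by exact_mod_cast hj
      have hi0 : (0 : ℝ) ≤ i := Nat.cast_nonneg i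
      have hj0 : (0 : ℝ) ≤ j := Nat.cast_nonneg j
      have hm : ((i : ℝ) + 1 / 2, (j : ℝ) + 1 / 2) ∈ ⋃ q ∈ D, closedSq q := by
        rw [hun]
        simp only [Set.mem_prod, Set.mem_Icc]
        refine ⟨⟨?_, ?_⟩, ?_, ?_⟩ <;> linarith
      simp only [Set.mem_iUnion] at hm
      obtain ⟨q, hq, hm⟩ := hm
      simp only [closedSq, Set.mem_prod, Set.mem_Icc] at hm
      exact ⟨q, hq, half_lo hm.1.1, half_hi hm.1.2, half_lo hm.2.1, half_hi hm.2.2⟩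
    · intro q hq q' hq' hne
      by_contra hc
      unfold sepSq at hc
      push Not at hc
      obtain ⟨u, hu⟩ := exists_common (a := q.1) (s := q.2.2) (b := q'.1) (t := q'.2.2)
        (by omega) (by omega) (hpos q hq) (hpos q' hq')
      obtain ⟨v, hv⟩ := exists_common (a := q.2.1) (s := q.2.2) (b := q'.2.1) (t := q'.2.2)
        (by omega) (by omega) (hpos q hq) (hpos q' hq')
      have hm : (u, v) ∈ openSq q ∩ openSq q' := by
        simp only [openSq, Set.mem_inter_iff, Set.mem_prod, Set.mem_Ioo]
        exact ⟨⟨hu.1, hv.1⟩, hu.2, hv.2⟩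
      rw [hdis q hq q' hq' hne] at hm
      exact hm
  · rintro ⟨hb, hc, hs⟩
    refine ⟨fun q hq => (hb q hq).1, ?_, ?_⟩
    · ext ⟨u, v⟩
      simp only [Set.mem_iUnion, closedSq, Set.mem_prod, Set.mem_Icc]
      constructor
      · rintro ⟨q, hq, ⟨h1, h2⟩, h3, h4⟩
        obtain ⟨-, hx, hy⟩ := hb q hq
        have hx' : (q.1 : ℝ) + q.2.2 ≤ n := by exact_mod_cast hx
        have hy' : (q.2.1 : ℝ) + q.2.2 ≤ n := by exact_mod_cast hy
        have a0 : (0 : ℝ) ≤ q.1 := Nat.cast_nonneg _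
        have b0 : (0 : ℝ) ≤ q.2.1 := Nat.cast_nonneg _
        refine ⟨⟨?_, ?_⟩, ?_, ?_⟩ <;> linarith
      · rintro ⟨⟨h1, h2⟩, h3, h4⟩
        obtain ⟨i, hi, hi1, hi2⟩ := exists_cell hn h1 h2
        obtain ⟨j, hj, hj1, hj2⟩ := exists_cell hn h3 h4
        obtain ⟨q, hq, c1, c2, c3, c4⟩ := hc i j hi hj
        have c1' : (q.1 : ℝ) ≤ i := by exact_mod_cast c1
        have c2' : (i : ℝ) + 1 ≤ q.1 + q.2.2 := by exact_mod_cast c2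
        have c3' : (q.2.1 : ℝ) ≤ j := by exact_mod_cast c3
        have c4' : (j : ℝ) + 1 ≤ q.2.1 + q.2.2 := by exact_mod_cast c4
        refine ⟨q, hq, ⟨?_, ?_⟩, ?_, ?_⟩ <;> linarith
    · intro q hq q' hq' hne
      rw [Set.eq_empty_iff_forall_notMem]
      rintro ⟨u, v⟩ hm
      simp only [openSq, Set.mem_inter_iff, Set.mem_prod, Set.mem_Ioo] at hm
      obtain ⟨⟨⟨a1, a2⟩, a3, a4⟩, ⟨b1, b2⟩, b3, b4⟩ := hm
      rcases hs q hq q' hq' hne with h | h | h | h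
      · have h' : (q.1 : ℝ) + q.2.2 ≤ q'.1 := by exact_mod_cast h
        linarith
      · have h' : (q'.1 : ℝ) + q'.2.2 ≤ q.1 := by exact_mod_cast h
        linarith
      · have h' : (q.2.1 : ℝ) + q.2.2 ≤ q'.2.1 := by exact_mod_cast h
        linarith
      · have h' : (q'.2.1 : ℝ) + q'.2.2 ≤ q.2.1 := by exact_mod_cast h
        linarith

def bigList (n : ℕ) : List (ℕ × ℕ × ℕ) :=
  ((List.range (n + 1)).product ((List.range (n + 1)).product (List.range (n + 1)))).filter
    (fun q => 2 ≤ q.2.2 ∧ q.1 + q.2.2 ≤ n ∧ q.2.1 + q.2.2 ≤ n)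

theorem mem_bigList {n : ℕ} {q : ℕ × ℕ × ℕ} :
    q ∈ bigList n ↔ 2 ≤ q.2.2 ∧ q.1 + q.2.2 ≤ n ∧ q.2.1 + q.2.2 ≤ n := by
  obtain ⟨a, b, c⟩ := q
  simp only [bigList, List.mem_filter, List.pair_mem_product, List.mem_range, decide_eq_true_eq]
  omega

theorem bigList_nodup (n : ℕ) : (bigList n).Nodup :=
  List.Nodup.filter _ (List.nodup_range.product (List.nodup_range.product List.nodup_range))

def Fam (l : List (ℕ × ℕ × ℕ)) : Finset (Finset (ℕ × ℕ × ℕ)) :=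
  l.toFinset.powerset.filter (fun S => ∀ p ∈ S, ∀ q ∈ S, p ≠ q → sepSq p q)

theorem mem_Fam {l : List (ℕ × ℕ × ℕ)} {S : Finset (ℕ × ℕ × ℕ)} :
    S ∈ Fam l ↔ (∀ q ∈ S, q ∈ l) ∧ ∀ p ∈ S, ∀ q ∈ S, p ≠ q → sepSq p q := by
  simp [Fam, Finset.subset_iff]

def cnt : ℕ → List (ℕ × ℕ × ℕ) → ℕ
  | _, [] => 1
  | 0, _ :: _ => 0
  | k + 1, a :: l => cnt k l + cnt k (l.filter (fun q => decide (sepSq a q)))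

theorem Fam_cons (a : ℕ × ℕ × ℕ) (l : List (ℕ × ℕ × ℕ)) (ha : a ∉ l) :
    Fam (a :: l) = Fam l ∪
      (Fam (l.filter (fun q => decide (sepSq a q)))).image (insert a) := by
  ext S
  simp only [Finset.mem_union, Finset.mem_image, mem_Fam, List.mem_cons, List.mem_filter,
    decide_eq_true_eq]
  constructor
  · rintro ⟨h1, h2⟩
    by_cases haS : a ∈ S
    · right
      refine ⟨S.erase a, ⟨?_, ?_⟩, Finset.insert_erase haS⟩
      · intro q hq
        rw [Finset.mem_erase] at hq
        exact ⟨(h1 q hq.2).resolve_left hq.1, h2 a haS q hq.2 (Ne.symm hq.1)⟩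
      · intro p hp q hq
        exact h2 p (Finset.mem_of_mem_erase hp) q (Finset.mem_of_mem_erase hq)
    · left
      refine ⟨fun q hq => (h1 q hq).resolve_left ?_, h2⟩
      rintro rfl
      exact haS hq
  · rintro (⟨h1, h2⟩ | ⟨T, ⟨h1, h2⟩, rfl⟩)
    · exact ⟨fun q hq => Or.inr (h1 q hq), h2⟩
    · constructor
      · intro q hq
        rcases Finset.mem_insert.1 hq with h | h
        · exact Or.inl h
        · exact Or.inr (h1 q h).1
      · intro p hp q hq hne
        rcases Finset.mem_insert.1 hp with h | h <;> rcases Finset.mem_insert.1 hq with h' | h'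
        · exact absurd (h.trans h'.symm) hne
        · rw [h]; exact (h1 q h').2
        · rw [h']; exact sepSq_symm (h1 p h).2
        · exact h2 p h q h' hne

theorem card_Fam (k : ℕ) : ∀ l : List (ℕ × ℕ × ℕ), l.Nodup → l.length ≤ k →
    (Fam l).card = cnt k l := by
  induction k with
  | zero =>
    intro l hl hk
    have : l = [] := List.length_eq_zero_iff.1 (by omega)
    subst this
    rfl
  | succ k ih =>
    intro l hl hk
    cases l with
    | nil => rfl
    | cons a l =>
      rw [List.nodup_cons] at hl
      rw [List.length_cons] at hk
      have hlen := List.length_filter_le (fun q => decide (sepSq a q)) l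
      have hna : ∀ T ∈ Fam (l.filter (fun q => decide (sepSq a q))), a ∉ T := by
        intro T hT haT
        exact hl.1 (List.mem_of_mem_filter ((mem_Fam.1 hT).1 a haT))
      rw [Fam_cons a l hl.1, Finset.card_union_of_disjoint, Finset.card_image_of_injOn, cnt,
        ih l hl.2 (by omega), ih _ (hl.2.filter _) (by omega)]
      · intro S hS T hT h
        have h' : insert a S = insert a T := h
        rw [← Finset.erase_insert (hna S hS), h', Finset.erase_insert (hna T hT)]
      · rw [Finset.disjoint_left]
        intro S hS hS'
        obtain ⟨T, -, rfl⟩ := Finset.mem_image.1 hS'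
        exact hl.1 ((mem_Fam.1 hS).1 a (Finset.mem_insert_self _ _))

theorem bij (n : ℕ) :
    Set.BijOn (fun D : Finset (ℕ × ℕ × ℕ) => D.filter (fun q => 2 ≤ q.2.2))
      {D | IsDisc n D} (Fam (bigList n) : Set (Finset (ℕ × ℕ × ℕ))) := by
  have key : ∀ D E : Finset (ℕ × ℕ × ℕ), IsDisc n D → IsDisc n E →
      D.filter (fun q => 2 ≤ q.2.2) = E.filter (fun q => 2 ≤ q.2.2) → D ⊆ E := by
    intro D E hD hE h q hq
    by_cases h2 : 2 ≤ q.2.2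
    · have : q ∈ D.filter (fun q => 2 ≤ q.2.2) := Finset.mem_filter.2 ⟨hq, h2⟩
      rw [h] at this
      exact (Finset.mem_filter.1 this).1
    · obtain ⟨b1, b2, b3⟩ := hD.1 q hq
      obtain ⟨q', hq', hc⟩ := hE.2.1 q.1 q.2.1 (by omega) (by omega)
      have hcq : covers q q.1 q.2.1 := by unfold covers; omega
      by_cases h2' : 2 ≤ q'.2.2
      · have : q' ∈ E.filter (fun q => 2 ≤ q.2.2) := Finset.mem_filter.2 ⟨hq', h2'⟩
        rw [← h] at this
        have hq'D := (Finset.mem_filter.1 this).1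
        have : q = q' := by
          by_contra hne
          exact covers_not_sep hcq hc (hD.2.2 q hq q' hq'D hne)
        rw [this]; exact hq'
      · have : q = q' := by
          obtain ⟨a, b, c⟩ := q
          obtain ⟨a', b', c'⟩ := q'
          simp only [covers] at hc b1 b2 b3 h2 h2'
          simp only [Prod.mk.injEq]
          omega
        rw [this]; exact hq'
  refine ⟨?_, ?_, ?_⟩
  · intro D hD
    simp only [Finset.mem_coe, mem_Fam, mem_bigList, Finset.mem_filter]
    refine ⟨fun q hq => ⟨hq.2, (hD.1 q hq.1).2⟩, fun p hp q hq => hD.2.2 p hp.1 q hq.1⟩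
  · intro D hD E hE h
    exact Finset.Subset.antisymm (key D E hD hE h) (key E D hE hD h.symm)
  · intro S hS
    rw [Finset.mem_coe, mem_Fam] at hS
    obtain ⟨h1, h2⟩ := hS
    simp only [mem_bigList] at h1
    classical
    let U : Finset (ℕ × ℕ × ℕ) :=
      (((Finset.range n) ×ˢ (Finset.range n)).filter
        (fun c => ¬ ∃ q ∈ S, covers q c.1 c.2)).image (fun c => (c.1, c.2, 1))
    have hU : ∀ q, q ∈ U ↔ q.1 < n ∧ q.2.1 < n ∧ q.2.2 = 1 ∧ ¬ ∃ p ∈ S, covers p q.1 q.2.1 := by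
      rintro ⟨a, b, c⟩
      simp only [U, Finset.mem_image, Finset.mem_filter, Finset.mem_product, Finset.mem_range,
        Prod.mk.injEq]
      constructor
      · rintro ⟨⟨a', b'⟩, ⟨⟨h1, h2⟩, h3⟩, rfl, rfl, rfl⟩
        exact ⟨h1, h2, rfl, h3⟩
      · rintro ⟨h1, h2, rfl, h3⟩
        exact ⟨(a, b), ⟨⟨h1, h2⟩, h3⟩, rfl, rfl, rfl⟩
    have hSU : ∀ p ∈ S, ∀ q ∈ U, sepSq p q := by
      intro p hp q hq
      obtain ⟨-, -, e, hn⟩ := (hU q).1 hq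
      by_contra hs
      apply hn
      refine ⟨p, hp, ?_⟩
      have := h1 p hp
      unfold sepSq at hs
      unfold covers
      omega
    refine ⟨S ∪ U, ⟨?_, ?_, ?_⟩, ?_⟩
    · intro q hq
      rcases Finset.mem_union.1 hq with h | h
      · have := h1 q h
        omega
      · have := (hU q).1 h
        omega
    · intro i j hi hj
      by_cases hc : ∃ q ∈ S, covers q i j
      · obtain ⟨q, hq, hc⟩ := hc
        exact ⟨q, Finset.mem_union_left _ hq, hc⟩
      · refine ⟨(i, j, 1), Finset.mem_union_right _ ((hU _).2 ⟨hi, hj, rfl, hc⟩), ?_⟩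
        simp [covers]
    · intro p hp q hq hne
      rcases Finset.mem_union.1 hp with h | h <;> rcases Finset.mem_union.1 hq with h' | h'
      · exact h2 p h q h' hne
      · exact hSU p h q h'
      · exact sepSq_symm (hSU q h' p h)
      · have e1 := (hU p).1 h
        have e2 := (hU q).1 h'
        by_contra hs
        apply hne
        obtain ⟨a, b, c⟩ := p
        obtain ⟨a', b', c'⟩ := q
        simp only [sepSq] at hs e1 e2
        simp only [Prod.mk.injEq]
        omega
    · ext q
      simp only [Finset.mem_filter, Finset.mem_union]
      constructor
      · rintro ⟨h | h, h'⟩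
        · exact h
        · have := ((hU q).1 h).2.2.1
          omega
      · intro h
        exact ⟨Or.inl h, (h1 q h).1⟩

theorem count_eq {n : ℕ} (hn : 0 < n) :
    {D : Finset (ℕ × ℕ × ℕ) | IsDissection n D}.ncard =
      cnt (bigList n).length (bigList n) := by
  have h := bij n
  have e : {D : Finset (ℕ × ℕ × ℕ) | IsDissection n D} = {D | IsDisc n D} := by
    ext D
    exact isDissection_iff hn D
  rw [e, ← h.injOn.ncard_image, h.image_eq, Set.ncard_coe_finset,
    card_Fam _ _ (bigList_nodup n) le_rfl]

theorem count_dissections_four_and_five :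
    {D : Finset (ℕ × ℕ × ℕ) | IsDissection 4 D}.ncard = 40 ∧
    {D : Finset (ℕ × ℕ × ℕ) | IsDissection 5 D}.ncard = 472 := by
  rw [count_eq (by norm_num), count_eq (by norm_num)]
  constructor <;> decide +kernel
end
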